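/- Fix n, B ∈ ℕ with B ≥ 1, and a subset O_obs ⊆ {1,…,n} with m := |O_obs| ≥ 1. For z ∈ ℝ let b*(z) be the least index b ∈ {1,…,B} such that |O^{(b)}(z)| ≤ |O^{(u)}(z)| for all u ∈ {1,…,B} (the first encountered model with the smallest outlier set), and let O_sel(z) = O^{(b*(z))}(z) be the outlier set selected by RANSAC. Then the truncation region {z ∈ ℝ : O_sel(z) = O_obs} equals the union over b ∈ {1,…,B} of the sets (⋂_{u=1}^{b−1} S^{(u)}_m) ∩ (⋂_{u=b+1}^{B} S^{(u)}_{m−1}) ∩ (S^{(b)}_{m−1} \ S^{(b)}_m) ∩ (⋂_{i ∉ O_obs} R_i^{(b)}) ∩ (⋂_{i ∈ O_obs} (ℝ \ R_i^{(b)})). -/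

import Mathlib

/-- The truncation region `{z : O_sel(z) = O_obs}` equals the union over models
`b` of the sub-regions characterized via the sets `S` and `R`. -/
theorem stmt_10 (n B : ℕ) (hB : 1 ≤ B)
    (R : Fin B → Fin n → Set ℝ)
    (Oobs : Set (Fin n)) (m : ℕ) (hm : m = Oobs.ncard) (hm1 : 1 ≤ m)
    (O : Fin B → ℝ → Set (Fin n)) (hO : ∀ u z, O u z = {i | z ∉ R u i})
    (S : Fin B → ℕ → Set ℝ) (hS : ∀ u k, S u k = {z : ℝ | k < (O u z).ncard})
    (bstar : ℝ → Fin B)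
    (hbstar : ∀ z : ℝ,
      (∀ u : Fin B, (O (bstar z) z).ncard ≤ (O u z).ncard) ∧
      ∀ b' : Fin B, (∀ u : Fin B, (O b' z).ncard ≤ (O u z).ncard) → bstar z ≤ b') :
    {z : ℝ | O (bstar z) z = Oobs} =
      ⋃ b : Fin B,
        ((⋂ u ∈ {u : Fin B | u < b}, S u m) ∩
          (⋂ u ∈ {u : Fin B | b < u}, S u (m - 1)) ∩
          (S b (m - 1) \ S b m) ∩
          (⋂ i ∈ Oobsᶜ, R b i) ∩
          (⋂ i ∈ Oobs, (R b i)ᶜ)) := by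
  have hmem : ∀ (b : Fin B) (z : ℝ) (i : Fin n), i ∈ O b z ↔ z ∉ R b i := by
    intro b z i
    rw [hO]
    rfl
  ext z
  obtain ⟨hmin, hfirst⟩ := hbstar z
  simp only [Set.mem_setOf_eq, Set.mem_iUnion, Set.mem_inter_iff, Set.mem_iInter, Set.mem_diff,
    hS, Set.mem_compl_iff, not_lt]
  constructor
  · intro h
    have hc : (O (bstar z) z).ncard = m := by rw [h, hm]
    refine ⟨bstar z, ⟨⟨⟨?_, ?_⟩, ?_, ?_⟩, ?_⟩, ?_⟩
    · intro u hu
      by_contra hcon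
      have := hfirst u (fun v => by have := hmin v; omega)
      exact absurd hu (not_lt.mpr this)
    · intro u _
      have := hmin u
      omega
    · omega
    · omega
    · intro i hi
      by_contra hcon
      exact hi (h ▸ (hmem _ _ _).2 hcon)
    · intro i hi
      exact (hmem _ _ _).1 (h.symm ▸ hi)
  · rintro ⟨b, ⟨⟨⟨h1, h2⟩, h3, h4⟩, h5⟩, h6⟩
    have hb : ∀ u, (O b z).ncard ≤ (O u z).ncard := by
      intro u
      rcases lt_trichotomy u b with hu | hu | hu
      · have := h1 u hu
        omega
      · rw [hu]
      · have := h2 u hu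
        omega
    have hle := hfirst b hb
    have heq : bstar z = b := by
      rcases hle.lt_or_eq with hlt | he
      · have := h1 _ hlt
        have := hmin b
        omega
      · exact he
    rw [heq]
    ext i
    rw [hmem]
    constructor
    · intro hi
      by_contra hcon
      exact hi (h5 i hcon)
    · exact h6 i
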